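/- arXiv:2404.18028 — 3 statements merged into one kernel-verified Lean document; each statement's English description precedes it below -/
import Mathlib

section
/- Let G be a finite simple graph on n vertices and let S be a dominating set of G such that every vertex x ∈ S has a semi-private neighbor, i.e., there exists a vertex y ∉ S whose only neighbor in S is x. Then |S| ≤ n/2. -/
/-- If `S` is a dominating set of a finite simple graph `G` on `n` vertices
such that every `x ∈ S` has a semi-private neighbor (a vertex `y ∉ S` whose only neighbor
in `S` is `x`), then `|S| ≤ n/2`, i.e. `2|S| ≤ n`. -/
theorem stmt_0 {V : Type*} [Fintype V] [DecidableEq V] (G : SimpleGraph V)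
    (S : Finset V)
    (hdom : ∀ v : V, v ∉ S → ∃ u ∈ S, G.Adj v u)
    (hsp : ∀ x ∈ S, ∃ y : V, y ∉ S ∧ G.neighborSet y ∩ (S : Set V) = {x}) :
    2 * S.card ≤ Fintype.card V := by
  choose! f hf using hsp
  have hcard : S.card ≤ Sᶜ.card := by
    refine Finset.card_le_card_of_injOn f
      (fun x hx => Finset.mem_coe.2 (Finset.mem_compl.2 (hf x hx).1)) ?_
    intro x hx y hy hxy
    have h := (hf x hx).2
    rw [hxy, (hf y hy).2] at h
    exact (Set.singleton_injective h).symm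
  have := Finset.card_add_card_compl S
  omega
end

section
/- Let G be a finite simple connected graph on n ≥ 2 vertices. Then the domination number satisfies γ(G) ≤ n/2, i.e., G has a dominating set S with 2|S| ≤ n. -/
/-- **Ore's theorem**: in a finite graph without isolated vertices, some dominating set contains
at most half of the vertices. -/
theorem SimpleGraph.exists_dominating_two_mul_card_le {V : Type*} [Fintype V] (G : SimpleGraph V)
    (hG : ∀ v, ∃ w, G.Adj v w) :
    ∃ S : Finset V, (∀ v : V, v ∉ S → ∃ u ∈ S, G.Adj v u) ∧
      2 * S.card ≤ Fintype.card V := by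
  classical
  obtain ⟨S, hS, hmin⟩ := Set.exists_min_image
    {S : Finset V | ∀ v : V, v ∉ S → ∃ u ∈ S, G.Adj v u} Finset.card (Set.toFinite _)
    ⟨Finset.univ, fun v hv => absurd (Finset.mem_univ v) hv⟩
  refine ⟨S, hS, ?_⟩
  have hcompl : ∀ v, v ∉ Sᶜ → ∃ u ∈ Sᶜ, G.Adj v u := by
    intro v hv
    rw [Finset.mem_compl, not_not] at hv
    by_contra! hv_nbr
    have hnbr : ∀ u, G.Adj v u → u ∈ S := fun u hu => by
      by_contra h
      exact hv_nbr u (Finset.mem_compl.2 h) hu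
    have herase : ∀ u, u ∉ S.erase v → ∃ x ∈ S.erase v, G.Adj u x := by
      intro u hu
      by_cases huv : u = v
      · subst huv
        obtain ⟨w, hw⟩ := hG u
        exact ⟨w, Finset.mem_erase.2 ⟨hw.ne', hnbr w hw⟩, hw⟩
      · have huS : u ∉ S := fun h => hu (Finset.mem_erase.2 ⟨huv, h⟩)
        obtain ⟨x, hx, hux⟩ := hS u huS
        refine ⟨x, Finset.mem_erase.2 ⟨?_, hx⟩, hux⟩
        rintro rfl
        exact huS (hnbr u hux.symm)
    exact (Finset.card_erase_lt_of_mem hv).not_ge (hmin _ herase)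
  have hle := hmin _ hcompl
  have hcard := S.card_add_card_compl
  omega

/-- Every finite simple connected graph on `n ≥ 2` vertices has a dominating
set `S` with `2|S| ≤ n`, i.e. its domination number is at most `n/2`. -/
theorem stmt_3 {V : Type*} [Fintype V] (G : SimpleGraph V)
    (hconn : G.Connected) (hn : 2 ≤ Fintype.card V) :
    ∃ S : Finset V, (∀ v : V, v ∉ S → ∃ u ∈ S, G.Adj v u) ∧
      2 * S.card ≤ Fintype.card V := by
  have : Nontrivial V := Fintype.one_lt_card_iff_nontrivial.1 hn
  exact G.exists_dominating_two_mul_card_le hconn.preconnected.exists_adj_of_nontrivial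
end

section
/- Let G be a finite simple graph on n vertices with maximum degree Δ satisfying 1 ≤ Δ ≤ 4, and let S* be a dominating set of G such that every vertex of S* has a semi-private neighbor (a vertex y ∉ S* whose only neighbor in S* is that vertex). Then |S*| ≤ ((Δ+1)/2) · γ(G), i.e., 2|S*| ≤ (Δ+1) · γ(G). -/
/-- A dominating set `S` satisfies `|V| ≤ (Δ + 1)|S|`. -/
theorem card_le_maxDegree_add_one_mul_card {V : Type*} [Fintype V] [DecidableEq V]
    (G : SimpleGraph V) [DecidableRel G.Adj] (S : Finset V)
    (hS : ∀ v : V, v ∉ S → ∃ u ∈ S, G.Adj v u) :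
    Fintype.card V ≤ (G.maxDegree + 1) * S.card := by
  have hcover : (Finset.univ : Finset V) ⊆ S.biUnion fun u => insert u (G.neighborFinset u) := by
    intro v _
    by_cases hv : v ∈ S
    · exact Finset.mem_biUnion.2 ⟨v, hv, Finset.mem_insert_self _ _⟩
    · obtain ⟨u, hu, huv⟩ := hS v hv
      exact Finset.mem_biUnion.2
        ⟨u, hu, Finset.mem_insert_of_mem ((G.mem_neighborFinset u v).2 huv.symm)⟩
  rw [mul_comm, ← Finset.card_univ]
  refine (Finset.card_le_card hcover).trans (Finset.card_biUnion_le_card_mul _ _ _ fun u _ => ?_)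
  refine (Finset.card_insert_le _ _).trans (Nat.succ_le_succ ?_)
  exact G.degree_le_maxDegree u

/-- If every vertex of `S` has a semi-private neighbor, then `2|S| ≤ |V|`. -/
theorem two_mul_card_le_of_semiPrivate {V : Type*} [Fintype V] [DecidableEq V]
    (G : SimpleGraph V) (S : Finset V)
    (hS : ∀ x ∈ S, ∃ y : V, y ∉ S ∧ G.neighborSet y ∩ (S : Set V) = {x}) :
    2 * S.card ≤ Fintype.card V := by
  choose! f hf hfx using hS
  have hle : S.card ≤ Sᶜ.card := by
    refine Finset.card_le_card_of_injOn f (fun x hx => by simpa using hf x hx) ?_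
    intro x hx y hy hxy
    exact Set.singleton_injective ((hfx x hx).symm.trans (hxy ▸ hfx y hy))
  have := Finset.card_add_card_compl S
  omega


/-- If `G` is a finite simple graph with maximum degree `Δ`, `1 ≤ Δ ≤ 4`,
and `S*` is a dominating set of `G` such that every vertex of `S*` has a semi-private
neighbor, then `2|S*| ≤ (Δ+1)·γ(G)`, where `γ(G)` is the domination number. -/
theorem stmt_11 {V : Type*} [Fintype V] [DecidableEq V] (G : SimpleGraph V)
    [DecidableRel G.Adj]
    (hΔ1 : 1 ≤ G.maxDegree) (hΔ4 : G.maxDegree ≤ 4)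
    (Sstar : Finset V)
    (hdom : ∀ v : V, v ∉ Sstar → ∃ u ∈ Sstar, G.Adj v u)
    (hsp : ∀ x ∈ Sstar, ∃ y : V, y ∉ Sstar ∧ G.neighborSet y ∩ (Sstar : Set V) = {x}) :
    2 * Sstar.card ≤ (G.maxDegree + 1) *
      sInf {k : ℕ | ∃ S : Finset V, (∀ v : V, v ∉ S → ∃ u ∈ S, G.Adj v u) ∧ S.card = k} := by
  obtain ⟨S, hS, hcard⟩ := Nat.sInf_mem
    (s := {k : ℕ | ∃ S : Finset V, (∀ v : V, v ∉ S → ∃ u ∈ S, G.Adj v u) ∧ S.card = k})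
    ⟨Sstar.card, Sstar, hdom, rfl⟩
  rw [← hcard]
  exact (two_mul_card_le_of_semiPrivate G Sstar hsp).trans
    (card_le_maxDegree_add_one_mul_card G S hS)
end
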